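/- There exists a fake null set F ⊆ ℤ^ω such that for every Miller tree T ⊆ ℤ^{<ω}, the set F + [T] is not fake null. -/

import Mathlib

open Pointwise Filter

/-- The length-`n` initial segment of `x : ℕ → ℤ`, as a finite sequence. -/
def res (x : ℕ → ℤ) (n : ℕ) : List ℤ := List.ofFn (fun i : Fin n => x (i : ℕ))

/-- A tree on `ℤ`: a set of finite integer sequences closed under initial segments. -/
def IsTree (T : Set (List ℤ)) : Prop := ∀ σ ∈ T, ∀ τ, τ <+: σ → τ ∈ T

/-- The set of infinite branches of a tree. -/
def branches (T : Set (List ℤ)) : Set (ℕ → ℤ) := {x | ∀ n, res x n ∈ T}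

/-- `σ` is a splitting node of `T` (at least two immediate successors). -/
def Splits (T : Set (List ℤ)) (σ : List ℤ) : Prop :=
  ∃ i j : ℤ, i ≠ j ∧ σ ++ [i] ∈ T ∧ σ ++ [j] ∈ T

/-- `σ` is an ω-splitting node of `T` (infinitely many immediate successors). -/
def OmegaSplits (T : Set (List ℤ)) (σ : List ℤ) : Prop :=
  {i : ℤ | σ ++ [i] ∈ T}.Infinite

/-- Perfect tree: a nonempty tree in which every node has a splitting extension. -/
def IsPerfect (T : Set (List ℤ)) : Prop :=
  IsTree T ∧ T.Nonempty ∧ ∀ σ ∈ T, ∃ τ ∈ T, σ <+: τ ∧ Splits T τ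

/-- Uniformly perfect tree: perfect, and on every level either all nodes split
or none do. -/
def IsUniformlyPerfect (T : Set (List ℤ)) : Prop :=
  IsPerfect T ∧ ∀ n : ℕ,
    (∀ σ ∈ T, σ.length = n → Splits T σ) ∨ (∀ σ ∈ T, σ.length = n → ¬ Splits T σ)

/-- Miller tree: a nonempty tree in which every node has an ω-splitting extension. -/
def IsMiller (T : Set (List ℤ)) : Prop :=
  IsTree T ∧ T.Nonempty ∧ ∀ σ ∈ T, ∃ τ ∈ T, σ <+: τ ∧ OmegaSplits T τ

/-- Laver tree: a tree with a stem `σ` such that every node is an initial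
segment of the stem, or extends it and is ω-splitting. -/
def IsLaver (T : Set (List ℤ)) : Prop :=
  IsTree T ∧ ∃ σ ∈ T, ∀ τ ∈ T, τ <+: σ ∨ (σ <+: τ ∧ OmegaSplits T τ)

/-- The ω-Silver tree with parameters `A` (set of free coordinates) and `xT`. -/
def silverTree (A : Set ℕ) (xT : ℕ → ℤ) : Set (List ℤ) :=
  {σ : List ℤ | ∀ n (h : n < σ.length), n ∉ A → σ.get ⟨n, h⟩ = xT n}

/-- ω-Silver tree: `σ ∈ T` iff `σ` agrees with `xT` outside an infinite set `A`. -/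
def IsOmegaSilver (T : Set (List ℤ)) : Prop :=
  ∃ A : Set ℕ, A.Infinite ∧ ∃ xT : ℕ → ℤ, T = silverTree A xT

/-- Membership in the σ-ideal `M₋`: `F` is covered by a set of the form
`{x : ∀∞ n, x↾Iₙ ≠ x_A↾Iₙ}` where the consecutive intervals `Iₙ = [a n, a (n+1))`
(`a` strictly monotone, `a 0 = 0`) partition `ω`. -/
def MemMminus (F : Set (ℕ → ℤ)) : Prop :=
  ∃ xA : ℕ → ℤ, ∃ a : ℕ → ℕ, a 0 = 0 ∧ StrictMono a ∧
    F ⊆ {x | ∀ᶠ n in Filter.atTop, ∃ k, a n ≤ k ∧ k < a (n + 1) ∧ x k ≠ xA k}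

/-- Membership in the ideal `nwd₋` generated by the sets
`{x : ∀ n, x↾Iₙ ≠ x_A↾Iₙ}`: `F` is covered by finitely many generators. -/
def MemNwdMinus (F : Set (ℕ → ℤ)) : Prop :=
  ∃ (m : ℕ) (xA : Fin m → ℕ → ℤ) (a : Fin m → ℕ → ℕ),
    (∀ i, a i 0 = 0 ∧ StrictMono (a i)) ∧
    F ⊆ ⋃ i, {x | ∀ n, ∃ k, a i n ≤ k ∧ k < a i (n + 1) ∧ x k ≠ xA i k}

/-- The basic clopen set `[σ]` of all extensions of `σ`. -/
def cyl (σ : List ℤ) : Set (ℕ → ℤ) := {x | res x σ.length = σ}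

/-- Fake null set: for every `ε > 0` it is covered by countably many cylinders
`[σₙ]` with `Σₙ 2^{-|σₙ|} < ε`. -/
def IsFakeNull (F : Set (ℕ → ℤ)) : Prop :=
  ∀ ε : ℝ, 0 < ε → ∃ σ : ℕ → List ℤ,
    Summable (fun n => (1 : ℝ) / 2 ^ (σ n).length) ∧
    (∑' n, (1 : ℝ) / 2 ^ (σ n).length) < ε ∧
    F ⊆ ⋃ n, cyl (σ n)

/-- `iterSum F B n` is the algebraic sum `F + B + B + ⋯ + B` (`n` copies of `B`). -/
def iterSum (F B : Set (ℕ → ℤ)) : ℕ → Set (ℕ → ℤ)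
  | 0 => F
  | n + 1 => iterSum F B n + B

/-- The sequences `f` such that, for infinitely many `n`, the initial segment of length `n` is
followed by as many zeros as the code of that segment. -/
def codedZeros : Set (ℕ → ℤ) :=
  {f | ∀ m, ∃ n ≥ m, ∀ i, n ≤ i → i < n + Encodable.encode (res f n) → f i = 0}

lemma length_res (x : ℕ → ℤ) (n : ℕ) : (res x n).length = n := by simp [res]

lemma getElem_res (x : ℕ → ℤ) (n i : ℕ) (h : i < (res x n).length) : (res x n)[i] = x i := by
  simp [res]

lemma res_congr {x y : ℕ → ℤ} {n : ℕ} (h : ∀ i < n, x i = y i) : res x n = res y n := by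
  simp only [res]
  congr 1
  funext i
  exact h i i.2

lemma res_prefix (x : ℕ → ℤ) {m n : ℕ} (h : m ≤ n) : res x m <+: res x n := by
  rw [List.prefix_iff_eq_take]
  apply List.ext_getElem
  · simp [length_res, h]
  · intro i h₁ h₂
    simp [getElem_res]

lemma res_getD (σ : List ℤ) : res (fun i => σ.getD i 0) σ.length = σ := by
  apply List.ext_getElem
  · simp [length_res]
  · intro i h₁ h₂
    simp [getElem_res, h₂]

lemma isFakeNull_codedZeros : IsFakeNull codedZeros := by
  intro ε hε
  obtain ⟨m, hm⟩ := exists_pow_lt_of_lt_one (half_pos hε) (by norm_num : (1 / 2 : ℝ) < 1)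
  let σ : ℕ → List ℤ := fun j =>
    Denumerable.ofNat (List ℤ) (j + m) ++ List.replicate (j + m) 0
  have hle : ∀ j, (1 : ℝ) / 2 ^ (σ j).length ≤ (1 / 2) ^ m * (1 / 2) ^ j := by
    intro j
    rw [← pow_add, one_div_pow]
    apply one_div_le_one_div_of_le (by positivity)
    apply pow_le_pow_right₀ (by norm_num)
    simp only [σ, List.length_append, List.length_replicate]
    omega
  have hs : Summable (fun j : ℕ => (1 / 2 : ℝ) ^ m * (1 / 2) ^ j) :=
    summable_geometric_two.mul_left _
  have hsum : Summable (fun j => (1 : ℝ) / 2 ^ (σ j).length) :=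
    Summable.of_nonneg_of_le (fun j => by positivity) hle hs
  refine ⟨σ, hsum, ?_, ?_⟩
  · calc _ ≤ ∑' j : ℕ, (1 / 2 : ℝ) ^ m * (1 / 2) ^ j := hsum.tsum_le_tsum hle hs
      _ = (1 / 2) ^ m * 2 := by rw [tsum_mul_left, tsum_geometric_two]
      _ < ε := by linarith
  · intro f hf
    have hinj : Function.Injective fun n => Encodable.encode (res f n) := by
      intro a b hab
      simpa [length_res] using congrArg List.length (Encodable.encode_injective hab)
    obtain ⟨N, hN⟩ := eventually_atTop.1
      ((hinj.nat_tendsto_atTop).eventually (eventually_ge_atTop m))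
    obtain ⟨n, hn, hz⟩ := hf N
    have hmn := hN n hn
    refine Set.mem_iUnion.2 ⟨Encodable.encode (res f n) - m, ?_⟩
    simp only [cyl, σ, Nat.sub_add_cancel hmn, Denumerable.ofNat_encode, Set.mem_ofPred_eq]
    apply List.ext_getElem
    · simp [length_res]
    · intro i h₁ h₂
      simp only [length_res, List.length_append, List.length_replicate] at h₁
      rw [getElem_res, List.getElem_append]
      split_ifs with h
      · rw [getElem_res]
      · rw [length_res] at h
        simpa using hz i (by omega) h₁

/-- No nonempty initial segment of `x` of length at most `n` belongs to `C`. -/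
def AvoidsUpTo (C : Set (List ℤ)) (x : ℕ → ℤ) (n : ℕ) : Prop :=
  ∀ j, 0 < j → j ≤ n → res x j ∉ C

lemma AvoidsUpTo.congr {C : Set (List ℤ)} {x y : ℕ → ℤ} {n : ℕ} (h : AvoidsUpTo C x n)
    (hxy : ∀ i < n, x i = y i) : AvoidsUpTo C y n := by
  intro j hj hjn
  rw [← res_congr fun i hi => hxy i (by omega)]
  exact h j hj hjn

lemma finite_entries {C : Set (List ℤ)} (hC : ∀ l, {σ ∈ C | σ.length = l}.Finite) (n l : ℕ) :
    {k : ℤ | ∃ σ ∈ C, σ.length ≤ l ∧ σ.getD n 0 = k}.Finite := by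
  have h : (⋃ i ∈ Set.Iic l, {σ ∈ C | σ.length = i}).Finite :=
    (Set.finite_Iic l).biUnion fun i _ => hC i
  refine (h.image fun σ => σ.getD n 0).subset ?_
  rintro k ⟨σ, hσ, hl, rfl⟩
  exact ⟨σ, by simpa using ⟨hσ, hl⟩, rfl⟩

/-- Choosing the entry at `n` outside a finite set takes care of all segments longer than `n`. -/
lemma AvoidsUpTo.of_entry {C : Set (List ℤ)} {x : ℕ → ℤ} {n l : ℕ} (h : AvoidsUpTo C x n)
    (hx : x n ∉ {k : ℤ | ∃ σ ∈ C, σ.length ≤ l ∧ σ.getD n 0 = k}) : AvoidsUpTo C x l := by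
  intro j hj hjl hjC
  rcases le_or_gt j n with hjn | hjn
  · exact h j hj hjn hjC
  · refine hx ⟨_, hjC, by rwa [length_res], ?_⟩
    rw [List.getD_eq_getElem _ _ (by rwa [length_res]), getElem_res]

lemma exists_avoidsUpTo_extension {C : Set (List ℤ)}
    (hC : ∀ l, {σ ∈ C | σ.length = l}.Finite) {f t : ℕ → ℤ} {n : ℕ}
    (h : AvoidsUpTo C (f + t) n) {n' : ℕ} (hn : n ≤ n') :
    ∃ f' : ℕ → ℤ, (∀ i < n, f' i = f i) ∧ AvoidsUpTo C (f' + t) n' := by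
  induction n', hn using Nat.le_induction with
  | base => exact ⟨f, fun _ _ => rfl, h⟩
  | succ l hl ih =>
    obtain ⟨g, hg, hgC⟩ := ih
    obtain ⟨k, hk⟩ := (finite_entries hC l (l + 1)).exists_notMem
    refine ⟨Function.update g l (k - t l), fun i hi => ?_, AvoidsUpTo.of_entry (n := l) ?_ ?_⟩
    · rw [Function.update_of_ne (by omega), hg i hi]
    · refine hgC.congr fun i hi => ?_
      simp [Function.update_of_ne hi.ne]
    · simpa using hk

lemma IsMiller.exists_extension_length {T : Set (List ℤ)} (hT : IsMiller T) {σ : List ℤ}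
    (hσ : σ ∈ T) (l : ℕ) : ∃ τ ∈ T, σ <+: τ ∧ l ≤ τ.length := by
  induction l with
  | zero => exact ⟨σ, hσ, List.prefix_rfl, Nat.zero_le _⟩
  | succ l ih =>
    obtain ⟨τ, hτ, hστ, hl⟩ := ih
    obtain ⟨ρ, -, hτρ, hρ⟩ := hT.2.2 τ hτ
    obtain ⟨k, hk⟩ := hρ.nonempty
    refine ⟨ρ ++ [k], hk, (hστ.trans hτρ).trans (List.prefix_append _ _), ?_⟩
    have := hτρ.length_le
    simp only [List.length_append, List.length_singleton]
    omega

lemma getD_eq_of_res_prefix {x : ℕ → ℤ} {n : ℕ} {τ : List ℤ} (h : res x n <+: τ) {i : ℕ}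
    (hi : i < n) : τ.getD i 0 = x i := by
  have hi' : i < (res x n).length := by rwa [length_res]
  rw [List.getD_eq_getElem _ _ (hi'.trans_le h.length_le), ← h.getElem hi', getElem_res]

/-- One step of the construction: extend `f` and the node `res t n` of `T` so that `f` acquires a
new block of zeros while the sum `f + t` keeps avoiding `C`. -/
lemma IsMiller.exists_step {T C : Set (List ℤ)} (hT : IsMiller T)
    (hC : ∀ l, {σ ∈ C | σ.length = l}.Finite) {f t : ℕ → ℤ} {n : ℕ} (ht : res t n ∈ T)
    (h : AvoidsUpTo C (f + t) n) :
    ∃ (f' t' : ℕ → ℤ) (n' : ℕ), n < n' ∧ (∀ i < n, f' i = f i) ∧ (∀ i < n, t' i = t i) ∧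
      res t' n' ∈ T ∧ AvoidsUpTo C (f' + t') n' ∧
      ∃ N ≥ n, N + Encodable.encode (res f' N) ≤ n' ∧
        ∀ i, N ≤ i → i < N + Encodable.encode (res f' N) → f' i = 0 := by
  obtain ⟨τ, hτ, htτ, hsplit⟩ := hT.2.2 _ ht
  set N := τ.length with hN
  have hnN : n ≤ N := by simpa [length_res] using htτ.length_le
  obtain ⟨g, hg, hgC⟩ := exists_avoidsUpTo_extension hC (t := fun i => τ.getD i 0)
    (h.congr (y := f + fun i => τ.getD i 0) fun i hi => by
      simp only [Pi.add_apply, getD_eq_of_res_prefix htτ hi]) hnN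
  let f' : ℕ → ℤ := fun i => if i < N then g i else 0
  set L := N + Encodable.encode (res f' N) + 1 with hL
  obtain ⟨k, hkT, hk⟩ := (hsplit.sdiff (finite_entries hC N L)).nonempty
  obtain ⟨ρ, hρ, hτρ, hlen⟩ := hT.exists_extension_length hkT L
  have hρi : ∀ i < N, ρ.getD i 0 = τ.getD i 0 := by
    intro i hi
    have hτρ' : τ <+: ρ := (List.prefix_append _ _).trans hτρ
    rw [List.getD_eq_getElem _ _ (hi.trans_le hτρ'.length_le), ← hτρ'.getElem hi,
      List.getD_eq_getElem]
  have hρN : ρ.getD N 0 = k := by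
    have hlt : N < (τ ++ [k]).length := by simp [hN]
    rw [List.getD_eq_getElem _ _ (hlt.trans_le hτρ.length_le), ← hτρ.getElem hlt]
    simp [hN]
  refine ⟨f', fun i => ρ.getD i 0, L, by omega, ?_, ?_, ?_, ?_, N, hnN, by omega, ?_⟩
  · intro i hi
    simp only [f', if_pos (hi.trans_le hnN), hg i hi]
  · intro i hi
    simp only [hρi i (hi.trans_le hnN), getD_eq_of_res_prefix htτ hi]
  · refine hT.1 _ hρ _ ?_
    have := res_prefix (fun i => ρ.getD i 0) hlen
    rwa [res_getD] at this
  · refine AvoidsUpTo.of_entry (n := N) (hgC.congr fun i hi => ?_) ?_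
    · simp only [Pi.add_apply, f', if_pos hi, hρi i hi]
    · simpa only [Pi.add_apply, f', lt_irrefl, if_false, zero_add, hρN] using hk
  · intro i hi _
    simp only [f', if_neg hi.not_gt]

lemma IsMiller.exists_avoiding_sum {T C : Set (List ℤ)} (hT : IsMiller T)
    (hC : ∀ l, {σ ∈ C | σ.length = l}.Finite) :
    ∃ f ∈ codedZeros, ∃ t ∈ branches T, ∀ n, AvoidsUpTo C (f + t) n := by
  let State := {p : (ℕ → ℤ) × (ℕ → ℤ) × ℕ //
    res p.2.1 p.2.2 ∈ T ∧ AvoidsUpTo C (p.1 + p.2.1) p.2.2}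
  have hnil : [] ∈ T := by
    obtain ⟨σ, hσ⟩ := hT.2.1
    exact hT.1 σ hσ _ List.nil_prefix
  have hstep : ∀ p : State, ∃ q : State, p.1.2.2 < q.1.2.2 ∧
      (∀ i < p.1.2.2, q.1.1 i = p.1.1 i) ∧ (∀ i < p.1.2.2, q.1.2.1 i = p.1.2.1 i) ∧
      ∃ N ≥ p.1.2.2, N + Encodable.encode (res q.1.1 N) ≤ q.1.2.2 ∧
        ∀ i, N ≤ i → i < N + Encodable.encode (res q.1.1 N) → q.1.1 i = 0 := by
    rintro ⟨⟨f, t, n⟩, ht, h⟩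
    obtain ⟨f', t', n', hn, hf, hf', ht', h', hz⟩ := hT.exists_step hC ht h
    exact ⟨⟨⟨f', t', n'⟩, ht', h'⟩, hn, hf, hf', hz⟩
  choose next hlt hnf hnt hzero using hstep
  let start : State := ⟨⟨0, 0, 0⟩, by simpa [res] using hnil, fun j hj hj' => by
    exact absurd hj' (by simpa using hj.ne')⟩
  let p : ℕ → State := fun m => next^[m] start
  have hp : ∀ m, p (m + 1) = next (p m) := fun m => Function.iterate_succ_apply' _ _ _
  have hmono : StrictMono fun m => (p m).1.2.2 :=
    strictMono_nat_of_lt_succ fun m => by simpa only [hp] using hlt (p m)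
  have hagree : ∀ {a b}, a ≤ b → ∀ i < (p a).1.2.2,
      (p b).1.1 i = (p a).1.1 i ∧ (p b).1.2.1 i = (p a).1.2.1 i := by
    intro a b hab i hi
    induction b, hab using Nat.le_induction with
    | base => exact ⟨rfl, rfl⟩
    | succ b hb ih =>
      have hib := hi.trans_le (hmono.monotone hb)
      rw [hp, hnf _ i hib, hnt _ i hib]
      exact ih
  have hself : ∀ i, i < (p (i + 1)).1.2.2 := fun i => hmono.le_apply (x := i + 1)
  let f : ℕ → ℤ := fun i => (p (i + 1)).1.1 i
  let t : ℕ → ℤ := fun i => (p (i + 1)).1.2.1 i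
  have hlim : ∀ m, ∀ i < (p m).1.2.2, (p m).1.1 i = f i ∧ (p m).1.2.1 i = t i := by
    intro m i hi
    rcases le_total m (i + 1) with hm | hm
    · exact ⟨(hagree hm i hi).1.symm, (hagree hm i hi).2.symm⟩
    · exact hagree hm i (hself i)
  refine ⟨f, ?_, t, ?_, ?_⟩
  · intro m
    obtain ⟨N, hN, hle, hz⟩ := hzero (p m)
    rw [← hp] at hle hz
    have hres : res (p (m + 1)).1.1 N = res f N :=
      res_congr fun i hi => (hlim (m + 1) i (by omega)).1
    rw [hres] at hle hz
    refine ⟨N, (hmono.le_apply (x := m)).trans hN, fun i hi hi' => ?_⟩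
    rw [← (hlim (m + 1) i (by omega)).1]
    exact hz i hi hi'
  · intro n
    have hn : n ≤ (p n).1.2.2 := hmono.le_apply
    rw [← res_congr fun i hi => (hlim n i (lt_of_lt_of_le hi hn)).2]
    exact hT.1 _ (p n).2.1 _ (res_prefix _ hn)
  · intro n j hj hjn
    refine ((p n).2.2.congr fun i hi => ?_) j hj (hjn.trans (hmono.le_apply (x := n)))
    simp only [Pi.add_apply, (hlim n i hi).1, (hlim n i hi).2]

lemma finite_range_length_eq {σ : ℕ → List ℤ}
    (hσ : Summable fun n => (1 : ℝ) / 2 ^ (σ n).length) (l : ℕ) :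
    {τ ∈ Set.range σ | τ.length = l}.Finite := by
  have hev := hσ.tendsto_cofinite_zero.eventually_lt_const
    (show (0 : ℝ) < 1 / 2 ^ l by positivity)
  refine ((eventually_cofinite.1 hev).image σ).subset ?_
  rintro _ ⟨⟨n, rfl⟩, hn⟩
  exact ⟨n, by simp [hn], rfl⟩

/-- There is a fake null `F` such that `F + [T]` is not fake null
for every Miller tree `T`. -/
theorem stmt14 : ∃ F : Set (ℕ → ℤ), IsFakeNull F ∧
    ∀ T : Set (List ℤ), IsMiller T → ¬ IsFakeNull (F + branches T) := by
  refine ⟨codedZeros, isFakeNull_codedZeros, fun T hT hnull => ?_⟩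
  obtain ⟨σ, hσ, hlt, hcover⟩ := hnull 1 one_pos
  obtain ⟨f, hf, t, ht, h⟩ := hT.exists_avoiding_sum (finite_range_length_eq hσ)
  obtain ⟨n, hn⟩ := Set.mem_iUnion.1 (hcover (Set.add_mem_add hf ht))
  have hn' : res (f + t) (σ n).length = σ n := hn
  refine h (σ n).length (σ n).length (Nat.pos_of_ne_zero fun h0 => ?_) le_rfl ⟨n, hn'.symm⟩
  have hle := hσ.le_tsum n fun j _ => by positivity
  rw [h0] at hle
  norm_num at hle
  norm_num at hlt
  linarith
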